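/- arXiv:1512.06848 — 2 statements merged into one kernel-verified Lean document; each statement's English description precedes it below -/
import Mathlib

section
/- Let n ≥ 4 be an integer, ε ∈ ℂ a primitive (2n−4)-th root of unity, and set L_{n−1} = x^{n−2} − i^n·y^{n−2} and L_n = x^{n−2} + i^n·y^{n−2} in ℂ[x,y], where i is the imaginary unit. Then for every integer k ≥ 0: the space {f ∈ ℂ[x,y] : f homogeneous of degree 2k(n−2), f(εx, ε^{−1}y) = f(x,y), and f(y, −x) = (−1)^{nk}·f(x,y)} equals the ℂ-linear span of the k+1 polynomials L_{n−1}^{2i}·L_n^{2(k−i)} for 0 ≤ i ≤ k. -/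
open MvPolynomial in
def stmtSpan {R : Type*} [CommRing R] [Algebra ℂ R] (A B : R) (k : ℕ) : Submodule ℂ R :=
  Submodule.span ℂ (Set.range (fun i : Fin (k + 1) => A ^ (2 * (i : ℕ)) * B ^ (2 * (k - (i : ℕ)))))

lemma stmtSpan_A {R : Type*} [CommRing R] [Algebra ℂ R] (A B : R) (k : ℕ) (a : R)
    (h : a ∈ stmtSpan A B k) : A ^ 2 * a ∈ stmtSpan A B (k + 1) := by
  induction h using Submodule.span_induction with
  | mem x hx =>
    obtain ⟨i, rfl⟩ := hx
    refine Submodule.subset_span ⟨i.succ, ?_⟩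
    have : k + 1 - (i.succ : ℕ) = k - i := by simp
    simp only [this]
    simp only [Fin.val_succ]
    ring
  | zero => simp
  | add x y _ _ hx hy => rw [mul_add]; exact add_mem hx hy
  | smul c x _ hx => rw [mul_smul_comm]; exact Submodule.smul_mem _ _ hx

lemma stmtSpan_B {R : Type*} [CommRing R] [Algebra ℂ R] (A B : R) (k : ℕ) (a : R)
    (h : a ∈ stmtSpan A B k) : B ^ 2 * a ∈ stmtSpan A B (k + 1) := by
  induction h using Submodule.span_induction with
  | mem x hx =>
    obtain ⟨i, rfl⟩ := hx
    refine Submodule.subset_span ⟨i.castSucc, ?_⟩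
    have : k + 1 - (i.castSucc : ℕ) = k - i + 1 := by
      have := i.2
      simp only [Fin.val_castSucc]; omega
    simp only [this]
    simp only [Fin.val_castSucc]
    ring
  | zero => simp
  | add x y _ _ hx hy => rw [mul_add]; exact add_mem hx hy
  | smul c x _ hx => rw [mul_smul_comm]; exact Submodule.smul_mem _ _ hx

lemma stmtSpan_uw {R : Type*} [CommRing R] [Algebra ℂ R] (u w : R) (k : ℕ) (a : R)
    (h : a ∈ stmtSpan (u - w) (u + w) k) : u * w * a ∈ stmtSpan (u - w) (u + w) (k + 1) := by
  have := Submodule.smul_mem _ (1/4 : ℂ) (sub_mem (stmtSpan_B _ _ _ _ h) (stmtSpan_A _ _ _ _ h))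
  convert this using 1
  have e : (u + w) ^ 2 * a - (u - w) ^ 2 * a = (4 : ℂ) • (u * w * a) := by
    rw [Algebra.smul_def, map_ofNat]; ring
  rw [e, smul_smul]; norm_num

lemma stmtSpan_sq {R : Type*} [CommRing R] [Algebra ℂ R] (u w : R) (k : ℕ) (a : R)
    (h : a ∈ stmtSpan (u - w) (u + w) k) :
    (u ^ 2 + w ^ 2) * a ∈ stmtSpan (u - w) (u + w) (k + 1) := by
  have := Submodule.smul_mem _ (1/2 : ℂ) (add_mem (stmtSpan_B _ _ _ _ h) (stmtSpan_A _ _ _ _ h))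
  convert this using 1
  have e : (u + w) ^ 2 * a + (u - w) ^ 2 * a = (2 : ℂ) • ((u ^ 2 + w ^ 2) * a) := by
    rw [Algebra.smul_def, map_ofNat]; ring
  rw [e, smul_smul]; norm_num

lemma stmtSpan_one {R : Type*} [CommRing R] [Algebra ℂ R] (A B : R) :
    (1 : R) ∈ stmtSpan A B 0 := Submodule.subset_span ⟨0, by simp⟩

lemma stmtSpan_pow {R : Type*} [CommRing R] [Algebra ℂ R] (u w : R) (k : ℕ) :
    u ^ (2 * k) + w ^ (2 * k) ∈ stmtSpan (u - w) (u + w) k := by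
  induction k using Nat.strong_induction_on with
  | _ k ih =>
    match k with
    | 0 => simpa using add_mem (stmtSpan_one (u - w) (u + w)) (stmtSpan_one (u - w) (u + w))
    | 1 => simpa using stmtSpan_sq u w 0 1 (stmtSpan_one _ _)
    | k + 2 =>
      have h1 := stmtSpan_sq u w _ _ (ih (k + 1) (by omega))
      have h2 := stmtSpan_uw u w _ _ (stmtSpan_uw u w _ _ (ih k (by omega)))
      convert sub_mem h1 h2 using 1
      ring

lemma stmtSpan_symm {R : Type*} [CommRing R] [Algebra ℂ R] (u w : R) (k j l : ℕ)
    (h : j + l = 2 * k) :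
    u ^ j * w ^ l + w ^ j * u ^ l ∈ stmtSpan (u - w) (u + w) k := by
  induction k generalizing j l with
  | zero =>
    obtain ⟨rfl, rfl⟩ : j = 0 ∧ l = 0 := by omega
    simpa using stmtSpan_pow u w 0
  | succ k ih =>
    match j, l with
    | 0, l =>
      obtain rfl : l = 2 * (k + 1) := by omega
      simpa [add_comm] using stmtSpan_pow u w (k + 1)
    | j, 0 =>
      obtain rfl : j = 2 * (k + 1) := by omega
      simpa [add_comm] using stmtSpan_pow u w (k + 1)
    | j + 1, l + 1 =>
      convert stmtSpan_uw u w _ _ (ih j l (by omega)) using 1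
      ring

open MvPolynomial in
lemma stmt_mono (d : Fin 2 →₀ ℕ) (a : ℂ) :
    (monomial d a : MvPolynomial (Fin 2) ℂ) = C a * (X 0 ^ d 0 * X 1 ^ d 1) := by
  rw [monomial_eq, Finsupp.prod_fintype _ _ (by simp)]
  simp

open MvPolynomial in
lemma stmt_coeff (ε δ : ℂ) (f : MvPolynomial (Fin 2) ℂ) (d : Fin 2 →₀ ℕ) :
    coeff d (aeval ![C ε * X 0, C δ * X 1] f) = ε ^ d 0 * δ ^ d 1 * coeff d f := by
  induction f using MvPolynomial.induction_on' with
  | add p q hp hq => simp only [map_add, coeff_add, hp, hq]; ring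
  | monomial e a =>
    have : aeval ![C ε * X 0, C δ * X 1] (monomial e a : MvPolynomial (Fin 2) ℂ)
        = monomial e (ε ^ e 0 * δ ^ e 1 * a) := by
      rw [stmt_mono, stmt_mono]
      simp [mul_pow, algebraMap_eq]
      ring
    rw [this, coeff_monomial, coeff_monomial]
    split_ifs with h
    · rw [h]
    · simp

lemma stmt_exp (m k a b : ℕ) (hm : 0 < m) (ε : ℂ) (hε : IsPrimitiveRoot ε (2 * m))
    (hab : a + b = 2 * k * m) (h : ε ^ a * ε⁻¹ ^ b = 1) :
    ∃ j l, a = j * m ∧ b = l * m ∧ j + l = 2 * k := by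
  have h0 : ε ≠ 0 := hε.ne_zero (by omega)
  have h1 : ε ^ (2 * a) = 1 := by
    have e : ε ^ a = ε ^ b := by
      rw [inv_pow] at h
      exact (mul_inv_eq_one₀ (pow_ne_zero _ h0)).1 h
    have : ε ^ (2 * a) = ε ^ (a + b) := by rw [two_mul, pow_add, pow_add, e]
    rw [this, hab, show 2 * k * m = 2 * m * k by ring, pow_mul, hε.pow_eq_one, one_pow]
  have h2 : m ∣ a := Nat.dvd_of_mul_dvd_mul_left (by norm_num) (hε.dvd_of_pow_eq_one _ h1)
  have h3 : m ∣ b := by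
    rw [← Nat.dvd_add_right h2, hab]; exact dvd_mul_left _ _
  obtain ⟨j, rfl⟩ := h2
  obtain ⟨l, rfl⟩ := h3
  refine ⟨j, l, by ring, by ring, ?_⟩
  apply Nat.eq_of_mul_eq_mul_left hm
  linarith

lemma stmt_I (n k : ℕ) : (-1 : ℂ) ^ (n * k) = (Complex.I ^ n) ^ (2 * k) := by
  rw [← Complex.I_sq, ← pow_mul, ← pow_mul]; congr 1; ring

lemma stmt_I' (m : ℕ) : (-1 : ℂ) ^ m = (Complex.I ^ (m + 2)) ^ 2 := by
  rw [← pow_mul, show (m + 2) * 2 = 2 * m + 4 by ring, pow_add, pow_mul, Complex.I_sq,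
    Complex.I_pow_four, mul_one]

lemma stmt_I4 (n : ℕ) : (Complex.I ^ n) ^ 4 = 1 := by
  rw [← pow_mul, mul_comm, pow_mul, Complex.I_pow_four, one_pow]

open MvPolynomial in
lemma stmt_T (m k : ℕ) (d : Fin 2 →₀ ℕ) (a : ℂ) (j l : ℕ)
    (h0 : d 0 = j * m) (h1 : d 1 = l * m) (hjl : j + l = 2 * k) :
    (monomial d a : MvPolynomial (Fin 2) ℂ) + ((-1 : ℂ) ^ ((m + 2) * k)) •
      aeval ![X 1, -X 0] (monomial d a : MvPolynomial (Fin 2) ℂ) ∈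
    stmtSpan (X 0 ^ m - C (Complex.I ^ (m + 2)) * X 1 ^ m : MvPolynomial (Fin 2) ℂ)
      (X 0 ^ m + C (Complex.I ^ (m + 2)) * X 1 ^ m) k := by
  have hs := stmtSpan_symm (X 0 ^ m : MvPolynomial (Fin 2) ℂ)
    (C (Complex.I ^ (m + 2)) * X 1 ^ m) k j l hjl
  have hs2 := Submodule.smul_mem _ (a * ((Complex.I ^ (m + 2)) ^ 3) ^ l) hs
  convert hs2 using 1
  rw [stmt_mono, h0, h1, stmt_I, ← hjl]
  have h4 : (C (Complex.I ^ (m + 2)) : MvPolynomial (Fin 2) ℂ) ^ 4 = 1 := by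
    rw [← C_pow, stmt_I4, C_1]
  have hm : (-X 0 : MvPolynomial (Fin 2) ℂ) ^ m = C (Complex.I ^ (m + 2)) ^ 2 * X 0 ^ m := by
    rw [neg_pow, ← C_pow, ← stmt_I']; simp
  simp only [smul_eq_C_mul, map_mul, aeval_C, algebraMap_eq, map_pow C, map_pow (aeval _), aeval_X,
    Matrix.cons_val_zero, Matrix.cons_val_one]
  simp only [map_pow] at h4 hm
  rw [mul_comm j m, mul_comm l m, pow_mul (-X 0 : MvPolynomial (Fin 2) ℂ), hm, pow_mul, pow_mul, pow_mul]
  generalize (C Complex.I ^ (m + 2) : MvPolynomial (Fin 2) ℂ) = W at *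
  have h5 : (W ^ 3) ^ l * W ^ l = 1 := by rw [← mul_pow, ← pow_succ, h4, one_pow]
  simp only [mul_pow, pow_add, ← pow_mul]
  linear_combination (-C a * (X 0 ^ (m * j)) * (X 1 ^ (m * l))) * h5

open MvPolynomial in
lemma stmt_gen1 (m p q : ℕ) (hn : 4 ≤ m + 2) (ε : ℂ) (hε : IsPrimitiveRoot ε (2 * m)) :
    aeval ![C ε * X 0, C ε⁻¹ * X 1] ((X 0 ^ m - C (Complex.I ^ (m + 2)) * X 1 ^ m : MvPolynomial (Fin 2) ℂ) ^ (2 * p) *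
      (X 0 ^ m + C (Complex.I ^ (m + 2)) * X 1 ^ m) ^ (2 * q)) = ((X 0 ^ m - C (Complex.I ^ (m + 2)) * X 1 ^ m : MvPolynomial (Fin 2) ℂ) ^ (2 * p) *
      (X 0 ^ m + C (Complex.I ^ (m + 2)) * X 1 ^ m) ^ (2 * q)) := by
  have hεm : ε ^ m = -1 := by
    have h2 : (ε ^ m) ^ 2 = 1 := by rw [← pow_mul, mul_comm, hε.pow_eq_one]
    rcases (sq_eq_sq_iff_eq_or_eq_neg.1 (h2.trans (one_pow 2).symm)) with h | h
    · exact absurd (Nat.le_of_dvd (by omega) (hε.dvd_of_pow_eq_one _ h)) (by omega)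
    · exact h
  have hεm' : ε⁻¹ ^ m = -1 := by rw [inv_pow, hεm]; norm_num
  simp only [map_mul, map_pow (aeval _), map_sub, map_add, aeval_C, algebraMap_eq, aeval_X,
    Matrix.cons_val_zero, Matrix.cons_val_one, mul_pow]
  rw [← C_pow ε, ← C_pow ε⁻¹, hεm, hεm']
  simp only [pow_mul, map_neg, C_1]
  ring

open MvPolynomial in
lemma stmt_gen0 (m p q : ℕ) :
    IsHomogeneous ((X 0 ^ m - C (Complex.I ^ (m + 2)) * X 1 ^ m : MvPolynomial (Fin 2) ℂ) ^ (2 * p) *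
      (X 0 ^ m + C (Complex.I ^ (m + 2)) * X 1 ^ m) ^ (2 * q)) (2 * (p + q) * m) := by
  have hX : ∀ s : Fin 2, (X s ^ m : MvPolynomial (Fin 2) ℂ).IsHomogeneous m := fun s => by
    have := (isHomogeneous_X ℂ s).pow m
    rwa [one_mul] at this
  have hW : (C (Complex.I ^ (m + 2)) * X 1 ^ m : MvPolynomial (Fin 2) ℂ).IsHomogeneous m := by
    have := (isHomogeneous_C (Fin 2) (Complex.I ^ (m + 2))).mul (hX 1)
    rwa [zero_add] at this
  have := (((hX 0).sub hW).pow (2 * p)).mul (((hX 0).add hW).pow (2 * q))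
  rw [show 2 * (p + q) * m = m * (2 * p) + m * (2 * q) by ring]
  exact this

open MvPolynomial in
lemma stmt_gen2 (m p q : ℕ) :
    aeval ![X 1, -X 0] ((X 0 ^ m - C (Complex.I ^ (m + 2)) * X 1 ^ m : MvPolynomial (Fin 2) ℂ) ^ (2 * p) *
      (X 0 ^ m + C (Complex.I ^ (m + 2)) * X 1 ^ m) ^ (2 * q)) = ((-1 : ℂ) ^ ((m + 2) * (p + q))) • ((X 0 ^ m - C (Complex.I ^ (m + 2)) * X 1 ^ m : MvPolynomial (Fin 2) ℂ) ^ (2 * p) *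
      (X 0 ^ m + C (Complex.I ^ (m + 2)) * X 1 ^ m) ^ (2 * q)) := by
  have hm : (-X 0 : MvPolynomial (Fin 2) ℂ) ^ m = C (Complex.I ^ (m + 2)) ^ 2 * X 0 ^ m := by
    rw [neg_pow, ← C_pow, ← stmt_I']; simp
  have h4 : (C (Complex.I ^ (m + 2)) : MvPolynomial (Fin 2) ℂ) ^ 4 = 1 := by
    rw [← C_pow, stmt_I4, C_1]
  rw [stmt_I]
  generalize (Complex.I ^ (m + 2)) = z at *
  rw [smul_eq_C_mul, C_pow]
  simp only [map_mul, map_pow (aeval _), map_sub, map_add, aeval_C, algebraMap_eq, aeval_X,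
    Matrix.cons_val_zero, Matrix.cons_val_one, hm]
  generalize (C z : MvPolynomial (Fin 2) ℂ) = W at *
  generalize (X 0 ^ m : MvPolynomial (Fin 2) ℂ) = u at *
  generalize (X 1 ^ m : MvPolynomial (Fin 2) ℂ) = v at *
  have e1 : (v - W * (W ^ 2 * u)) ^ 2 = W ^ 2 * (u - W * v) ^ 2 := by
    linear_combination (-v^2 + W^2*u^2) * h4
  have e2 : (v + W * (W ^ 2 * u)) ^ 2 = W ^ 2 * (u + W * v) ^ 2 := by
    linear_combination (-v^2 + W^2*u^2) * h4
  simp only [pow_mul, e1, e2, mul_pow, pow_add]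
  ring

open MvPolynomial in
/-- for the binary dihedral action of type `D_n` (generated by
`x ↦ εx, y ↦ ε⁻¹y` and `x ↦ y, y ↦ −x`), the isotypic piece
`{f homogeneous of degree 2k(n−2), f(εx,ε⁻¹y)=f, f(y,−x)=(−1)^{nk} f}` is spanned by
the `k+1` polynomials `L_{n−1}^{2i} L_n^{2(k−i)}`, where `L_{n−1} = x^{n−2} − iⁿ y^{n−2}`
and `L_n = x^{n−2} + iⁿ y^{n−2}`. -/
theorem stmt15 (n : ℕ) (hn : 4 ≤ n) (ε : ℂ) (hε : IsPrimitiveRoot ε (2 * n - 4)) (k : ℕ) :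
    {f : MvPolynomial (Fin 2) ℂ |
        f.IsHomogeneous (2 * k * (n - 2)) ∧
        aeval ![C ε * X 0, C ε⁻¹ * X 1] f = f ∧
        aeval ![X 1, -X 0] f = ((-1 : ℂ) ^ (n * k)) • f}
      = (Submodule.span ℂ (Set.range (fun i : Fin (k + 1) =>
          ((X 0 ^ (n - 2) - C (Complex.I ^ n) * X 1 ^ (n - 2) : MvPolynomial (Fin 2) ℂ)
              ^ (2 * (i : ℕ))) *
          ((X 0 ^ (n - 2) + C (Complex.I ^ n) * X 1 ^ (n - 2)) ^ (2 * (k - (i : ℕ)))))) :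
            Set (MvPolynomial (Fin 2) ℂ)) := by
  obtain ⟨m, rfl⟩ : ∃ m, n = m + 2 := ⟨n - 2, by omega⟩
  rw [show 2 * (m + 2) - 4 = 2 * m by omega] at hε
  simp only [Nat.add_sub_cancel]
  change _ = (stmtSpan (X 0 ^ m - C (Complex.I ^ (m + 2)) * X 1 ^ m : MvPolynomial (Fin 2) ℂ)
      (X 0 ^ m + C (Complex.I ^ (m + 2)) * X 1 ^ m) k : Set (MvPolynomial (Fin 2) ℂ))
  ext f
  simp only [Set.mem_ofPred_eq, SetLike.mem_coe]
  constructor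
  · rintro ⟨hf, h1, h2⟩
    have hc : ((-1 : ℂ) ^ ((m + 2) * k)) * ((-1 : ℂ) ^ ((m + 2) * k)) = 1 := by
      rw [← mul_pow]; norm_num
    let T : MvPolynomial (Fin 2) ℂ →ₗ[ℂ] MvPolynomial (Fin 2) ℂ :=
      LinearMap.id + ((-1 : ℂ) ^ ((m + 2) * k)) •
        (aeval ![X 1, -X 0] : MvPolynomial (Fin 2) ℂ →ₐ[ℂ] MvPolynomial (Fin 2) ℂ).toLinearMap
    have hT : ∀ g, T g = g + ((-1 : ℂ) ^ ((m + 2) * k)) • aeval ![X 1, -X 0] g := fun g => rfl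
    have hTf : T f = (2 : ℂ) • f := by
      rw [hT, h2, smul_smul, hc, one_smul, two_smul]
    have hf2 : f = (1 / 2 : ℂ) • T f := by rw [hTf, smul_smul]; norm_num
    rw [hf2]
    apply Submodule.smul_mem
    rw [f.as_sum, map_sum]
    refine Submodule.sum_mem _ fun d hd => ?_
    have hd' := mem_support_iff.1 hd
    have hdeg : d 0 + d 1 = 2 * k * m := by
      have := hf hd'
      rw [Finsupp.weight_apply, Finsupp.sum_fintype _ _ (by simp)] at this
      simpa using this
    have he : ε ^ d 0 * ε⁻¹ ^ d 1 = 1 := by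
      have := stmt_coeff ε ε⁻¹ f d
      rw [h1] at this
      exact mul_right_cancel₀ hd' (by rw [one_mul, ← this])
    obtain ⟨j, l, hj, hl, hjl⟩ := stmt_exp m k _ _ (by omega) ε hε hdeg he
    exact stmt_T m k d _ j l hj hl hjl
  · intro h
    induction h using Submodule.span_induction with
    | zero => exact ⟨isHomogeneous_zero _ _ _, by simp, by simp⟩
    | add x y _ _ hx hy =>
      exact ⟨hx.1.add hy.1, by rw [map_add, hx.2.1, hy.2.1], by rw [map_add, hx.2.2, hy.2.2, smul_add]⟩
    | smul c x _ hx =>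
      refine ⟨?_, by rw [map_smul, hx.2.1], by rw [map_smul, hx.2.2, smul_comm]⟩
      rw [smul_eq_C_mul]
      simpa using (isHomogeneous_C _ c).mul hx.1
    | mem x hx =>
      obtain ⟨i, rfl⟩ := hx
      dsimp only
      have hi : (i : ℕ) + (k - i) = k := by have := i.2; omega
      generalize (i : ℕ) = p at *
      generalize k - p = q at *
      subst hi
      exact ⟨stmt_gen0 m p q, stmt_gen1 m p q hn ε hε, stmt_gen2 m p q⟩
end

section
/- Let n ≥ 4 be an integer, ε ∈ ℂ a primitive (2n−4)-th root of unity, and set L_{n−1} = x^{n−2} − i^n·y^{n−2} and L_n = x^{n−2} + i^n·y^{n−2} in ℂ[x,y], where i is the imaginary unit. Then for every integer k ≥ 1: the space {f ∈ ℂ[x,y] : f homogeneous of degree 2k(n−2), f(εx, ε^{−1}y) = f(x,y), and f(y, −x) = (−1)^{nk+1}·f(x,y)} equals the ℂ-linear span of the k polynomials L_{n−1}^{2i+1}·L_n^{2(k−i)−1} for 0 ≤ i ≤ k−1. -/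
open MvPolynomial in
theorem aux_coeff (a b : ℂ) (f : MvPolynomial (Fin 2) ℂ) (d : Fin 2 →₀ ℕ) :
    coeff d (aeval ![C a * X 0, C b * X 1] f) = a ^ d 0 * b ^ d 1 * coeff d f := by
  induction f using MvPolynomial.induction_on' with
  | monomial e r =>
    have h : aeval ![C a * X 0, C b * X 1] (monomial e r)
        = monomial e (a ^ e 0 * b ^ e 1 * r) := by
      rw [aeval_monomial, Finsupp.prod_fintype _ _ (by simp), monomial_eq,
        Finsupp.prod_fintype _ _ (by simp)]
      simp only [Fin.prod_univ_two, Matrix.cons_val_zero, Matrix.cons_val_one, mul_pow,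
        C_mul, C_pow, algebraMap_eq]
      ring
    rw [h, coeff_monomial, coeff_monomial]
    split_ifs with h
    · subst h; rfl
    · simp
  | add p q hp hq => rw [map_add, coeff_add, coeff_add, hp, hq]; ring

def auxV {A : Type*} [CommRing A] [Algebra ℂ A] (P Q : A) (N : ℕ) : Submodule ℂ A :=
  Submodule.span ℂ {z | ∃ a b : ℕ, a + b = N ∧ z = P ^ a * Q ^ b}

theorem auxV_mul {A : Type*} [CommRing A] [Algebra ℂ A] (P Q : A) (N : ℕ) (r s : ℂ) (z : A)
    (hz : z ∈ auxV P Q N) : (r • P + s • Q) * z ∈ auxV P Q (N + 1) := by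
  induction hz using Submodule.span_induction with
  | mem x hx =>
    obtain ⟨a, b, h, rfl⟩ := hx
    have : (r • P + s • Q) * (P ^ a * Q ^ b)
        = r • (P ^ (a+1) * Q ^ b) + s • (P ^ a * Q ^ (b+1)) := by
      simp only [add_mul, smul_mul_assoc]
      congr 2 <;> ring
    rw [this]
    refine Submodule.add_mem _ (Submodule.smul_mem _ _ (Submodule.subset_span ?_))
      (Submodule.smul_mem _ _ (Submodule.subset_span ?_))
    · exact ⟨a+1, b, by omega, rfl⟩
    · exact ⟨a, b+1, by omega, rfl⟩
  | zero => simp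
  | add x y _ _ hx hy => rw [mul_add]; exact Submodule.add_mem _ hx hy
  | smul c x _ hx => rw [mul_smul_comm]; exact Submodule.smul_mem _ _ hx

theorem auxV_pow {A : Type*} [CommRing A] [Algebra ℂ A] (P Q : A) (r s r' s' : ℂ) (j l : ℕ) :
    (r • P + s • Q) ^ j * (r' • P + s' • Q) ^ l ∈ auxV P Q (j + l) := by
  induction j with
  | zero =>
    induction l with
    | zero => exact Submodule.subset_span ⟨0, 0, rfl, by simp⟩
    | succ l ih =>
      have := auxV_mul P Q _ r' s' _ ih
      rwa [mul_left_comm, ← pow_succ'] at this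
  | succ j ih =>
    have := auxV_mul P Q _ r s _ ih
    rwa [← mul_assoc, ← pow_succ', show j + l + 1 = j + 1 + l by omega] at this

open MvPolynomial in
theorem aux_mem (m : ℕ) (hm : 1 ≤ m) (ε : ℂ) (hε : IsPrimitiveRoot ε (2 * m)) (c : ℂ)
    (hc : c ≠ 0) (k : ℕ) (f : MvPolynomial (Fin 2) ℂ)
    (h1 : f.IsHomogeneous (2 * k * m))
    (h2 : aeval ![C ε * X 0, C ε⁻¹ * X 1] f = f) :
    f ∈ auxV (X 0 ^ m - C c * X 1 ^ m : MvPolynomial (Fin 2) ℂ) (X 0 ^ m + C c * X 1 ^ m)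
      (2 * k) := by
  rw [f.as_sum]
  refine Submodule.sum_mem _ fun d hd => ?_
  have hd' : coeff d f ≠ 0 := by simpa using hd
  have hdeg : d 0 + d 1 = 2 * k * m := by
    have := h1 hd'
    rw [Finsupp.weight_apply, Finsupp.sum_fintype _ _ (by simp)] at this
    simpa [Fin.sum_univ_two] using this
  have hε0 : ε ≠ 0 := hε.ne_zero (by omega)
  have he : ε ^ d 0 = ε ^ d 1 := by
    have := aux_coeff ε ε⁻¹ f d
    rw [h2] at this
    have h3 : ε ^ d 0 * ε⁻¹ ^ d 1 = 1 := by
      apply mul_right_cancel₀ hd'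
      rw [← this, one_mul]
    rw [inv_pow] at h3
    field_simp at h3
    exact h3
  have hmod : (2 * m : ℤ) ∣ (d 0 : ℤ) - d 1 := by
    have := (hε.zpow_eq_one_iff_dvd ((d 0 : ℤ) - d 1)).1 (by
      rw [zpow_sub₀ hε0, zpow_natCast, zpow_natCast, he, div_self (pow_ne_zero _ hε0)])
    exact_mod_cast this
  have hm0 : m ∣ d 0 := by
    obtain ⟨t, ht⟩ := hmod
    have h4 : (d 0 : ℤ) + d 1 = 2 * k * m := by exact_mod_cast hdeg
    have : (m : ℤ) ∣ d 0 := ⟨t + k, by linarith⟩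
    exact_mod_cast this
  obtain ⟨j, hj⟩ := hm0
  have hm1 : m ∣ d 1 := (Nat.dvd_add_right ⟨j, hj⟩).1 (hdeg ▸ Dvd.intro_left _ rfl)
  obtain ⟨l, hl⟩ := hm1
  have hjl : j + l = 2 * k := by
    rw [hj, hl] at hdeg
    exact Nat.eq_of_mul_eq_mul_left hm (by linarith)
  have key : monomial d (coeff d f) = (coeff d f) •
      (((1/2 : ℂ) • (X 0 ^ m - C c * X 1 ^ m : MvPolynomial (Fin 2) ℂ)
        + (1/2 : ℂ) • (X 0 ^ m + C c * X 1 ^ m)) ^ j *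
      ((-(1/(2*c)) : ℂ) • (X 0 ^ m - C c * X 1 ^ m : MvPolynomial (Fin 2) ℂ)
        + (1/(2*c) : ℂ) • (X 0 ^ m + C c * X 1 ^ m)) ^ l) := by
    have e1 : ((1/2 : ℂ) • (X 0 ^ m - C c * X 1 ^ m : MvPolynomial (Fin 2) ℂ)
        + (1/2 : ℂ) • (X 0 ^ m + C c * X 1 ^ m)) = X 0 ^ m := by
      module
    have e2 : ((-(1/(2*c)) : ℂ) • (X 0 ^ m - C c * X 1 ^ m : MvPolynomial (Fin 2) ℂ)
        + (1/(2*c) : ℂ) • (X 0 ^ m + C c * X 1 ^ m)) = X 1 ^ m := by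
      rw [← smul_eq_C_mul]
      match_scalars <;> field_simp <;> ring
    rw [e1, e2, monomial_eq, Finsupp.prod_fintype _ _ (by simp), Fin.prod_univ_two, hj, hl,
      smul_eq_C_mul, pow_mul, pow_mul]
  rw [key, ← hjl]
  exact Submodule.smul_mem _ _ (auxV_pow _ _ _ _ _ _ _ _)


open MvPolynomial in
/-- for the binary dihedral action of type `D_n`, the isotypic piece
`{f homogeneous of degree 2k(n−2), f(εx,ε⁻¹y)=f, f(y,−x)=(−1)^{nk+1} f}` (k ≥ 1) is
spanned by the `k` polynomials `L_{n−1}^{2i+1} L_n^{2(k−i)−1}`, `0 ≤ i ≤ k−1`, where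
`L_{n−1} = x^{n−2} − iⁿ y^{n−2}` and `L_n = x^{n−2} + iⁿ y^{n−2}`. -/
theorem stmt16 (n : ℕ) (hn : 4 ≤ n) (ε : ℂ) (hε : IsPrimitiveRoot ε (2 * n - 4))
    (k : ℕ) (hk : 1 ≤ k) :
    {f : MvPolynomial (Fin 2) ℂ |
        f.IsHomogeneous (2 * k * (n - 2)) ∧
        aeval ![C ε * X 0, C ε⁻¹ * X 1] f = f ∧
        aeval ![X 1, -X 0] f = ((-1 : ℂ) ^ (n * k + 1)) • f}
      = (Submodule.span ℂ (Set.range (fun i : Fin k =>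
          ((X 0 ^ (n - 2) - C (Complex.I ^ n) * X 1 ^ (n - 2) : MvPolynomial (Fin 2) ℂ)
              ^ (2 * (i : ℕ) + 1)) *
          ((X 0 ^ (n - 2) + C (Complex.I ^ n) * X 1 ^ (n - 2)) ^ (2 * (k - (i : ℕ)) - 1)))) :
            Set (MvPolynomial (Fin 2) ℂ)) := by
  obtain ⟨m, rfl⟩ : ∃ m, n = m + 2 := ⟨n - 2, by omega⟩
  have hm : 1 ≤ m := by omega
  rw [show 2 * (m + 2) - 4 = 2 * m by omega] at hε
  simp only [Nat.add_sub_cancel]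
  obtain ⟨c, hc⟩ : ∃ c, c = Complex.I ^ (m + 2) := ⟨_, rfl⟩
  rw [← hc]
  have hc0 : c ≠ 0 := hc ▸ pow_ne_zero _ Complex.I_ne_zero
  have hc2 : c ^ 2 = (-1) ^ (m + 2) := by
    rw [hc, ← pow_mul, mul_comm, pow_mul, Complex.I_sq]
  have hcm : (-1 : ℂ) ^ m = c ^ 2 := by rw [hc2]; ring
  have hc4 : c ^ 4 = 1 := by
    rw [show 4 = 2 * 2 from rfl, pow_mul, ← hcm, ← pow_mul, mul_comm, pow_mul]; simp
  have hCc4 : (C c : MvPolynomial (Fin 2) ℂ) ^ 4 = 1 := by rw [← C_pow, hc4, C_1]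
  have hCcm : (-1 : MvPolynomial (Fin 2) ℂ) ^ m = C c ^ 2 := by
    rw [← C_pow, ← hcm]; simp
  obtain ⟨P, hP⟩ : ∃ P : MvPolynomial (Fin 2) ℂ, P = X 0 ^ m - C c * X 1 ^ m := ⟨_, rfl⟩
  obtain ⟨Q, hQ⟩ : ∃ Q : MvPolynomial (Fin 2) ℂ, Q = X 0 ^ m + C c * X 1 ^ m := ⟨_, rfl⟩
  have hmem := fun f h1 h2 => aux_mem m hm ε hε c hc0 k f h1 h2
  rw [← hP, ← hQ] at hmem ⊢
  have hsP : aeval ![X 1, -X 0] P = -C c ^ 3 * P := by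
    rw [hP]
    simp only [map_sub, map_mul, map_pow, aeval_X, Matrix.cons_val_zero, Matrix.cons_val_one,
      aeval_C, algebraMap_eq]
    rw [neg_pow, hCcm]
    linear_combination (-X 1 ^ m) * hCc4
  have hsQ : aeval ![X 1, -X 0] Q = C c ^ 3 * Q := by
    rw [hQ]
    simp only [map_add, map_mul, map_pow, aeval_X, Matrix.cons_val_zero, Matrix.cons_val_one,
      aeval_C, algebraMap_eq]
    rw [neg_pow, hCcm]
    linear_combination (-X 1 ^ m) * hCc4
  have hs : ∀ a b : ℕ, a + b = 2 * k → aeval ![X 1, -X 0] (P ^ a * Q ^ b)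
      = ((-1 : ℂ) ^ ((m + 2) * k + a)) • (P ^ a * Q ^ b) := by
    intro a b hab
    rw [map_mul, map_pow, map_pow, hsP, hsQ, mul_pow, mul_pow, neg_pow, smul_eq_C_mul, pow_add,
      pow_mul, ← hc2, C_mul, C_pow, C_pow, C_pow, C_neg, C_1]
    have : (C c ^ 3 : MvPolynomial (Fin 2) ℂ) ^ a * (C c ^ 3) ^ b = (C c ^ 2) ^ k := by
      rw [← pow_add, hab, pow_mul]
      congr 1
      linear_combination (C c ^ 2) * hCc4
    linear_combination ((-1) ^ a * P ^ a * Q ^ b) * this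
  have hε0 : ε ≠ 0 := hε.ne_zero (by omega)
  have he2 : (ε ^ m) ^ 2 = 1 := by rw [← pow_mul, mul_comm, hε.pow_eq_one]
  have hei : (ε⁻¹) ^ m = ε ^ m := by
    rw [inv_pow]; exact inv_eq_of_mul_eq_one_left (by rw [← he2]; ring)
  have htP : aeval ![C ε * X 0, C ε⁻¹ * X 1] P = C (ε ^ m) * P := by
    rw [hP]
    simp only [map_sub, map_mul, map_pow, aeval_X, Matrix.cons_val_zero, Matrix.cons_val_one,
      aeval_C, algebraMap_eq, mul_pow]
    rw [← C_pow, ← C_pow, hei]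
    ring
  have htQ : aeval ![C ε * X 0, C ε⁻¹ * X 1] Q = C (ε ^ m) * Q := by
    rw [hQ]
    simp only [map_add, map_mul, map_pow, aeval_X, Matrix.cons_val_zero, Matrix.cons_val_one,
      aeval_C, algebraMap_eq, mul_pow]
    rw [← C_pow, ← C_pow, hei]
    ring
  have hX0 : (X 0 ^ m : MvPolynomial (Fin 2) ℂ).IsHomogeneous m := isHomogeneous_X_pow 0 m
  have hX1 : (C c * X 1 ^ m : MvPolynomial (Fin 2) ℂ).IsHomogeneous m := by
    simpa using (isHomogeneous_C (Fin 2) c).mul (isHomogeneous_X_pow (R := ℂ) (1 : Fin 2) m)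
  have hhP : P.IsHomogeneous m := hP ▸ hX0.sub hX1
  have hhQ : Q.IsHomogeneous m := hQ ▸ hX0.add hX1
  ext f
  simp only [Set.mem_setOf_eq, SetLike.mem_coe]
  constructor
  · rintro ⟨h1, h2, h3⟩
    obtain ⟨s, hsd⟩ : ∃ s : ℂ, s = (-1) ^ ((m + 2) * k + 1) := ⟨_, rfl⟩
    have hss : s * s = 1 := by rw [hsd, ← mul_pow]; simp
    rw [← hsd] at h3
    have hf : f = (1/2 : ℂ) • (f + s • aeval ![X 1, -X 0] f) := by
      rw [h3, smul_smul, hss]; module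
    rw [hf]
    have hfm := hmem f h1 h2
    clear hf h1 h2 h3
    refine Submodule.smul_mem _ _ ?_
    induction hfm using Submodule.span_induction with
    | mem x hx =>
      obtain ⟨a, b, hab, rfl⟩ := hx
      rw [hs a b hab, smul_smul]
      rcases Nat.even_or_odd a with ha | ha
      · have : s * (-1) ^ ((m + 2) * k + a) = -1 := by
          rw [pow_add, ha.neg_one_pow]
          linear_combination (-1 : ℂ) * hss + s * hsd
        rw [this]; simp
      · have : s * (-1) ^ ((m + 2) * k + a) = 1 := by
          rw [pow_add, ha.neg_one_pow]
          linear_combination hss - s * hsd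
        rw [this, one_smul, ← two_smul ℂ]
        refine Submodule.smul_mem _ _ (Submodule.subset_span ?_)
        obtain ⟨i, rfl⟩ := ha
        refine ⟨⟨i, by omega⟩, ?_⟩
        simp only
        rw [show 2 * (k - i) - 1 = b by omega]
    | zero => simp
    | add x y _ _ hx hy =>
      have := Submodule.add_mem _ hx hy
      convert this using 1
      rw [map_add]; module
    | smul r x _ hx =>
      have := Submodule.smul_mem _ r hx
      convert this using 1
      rw [map_smul]; module
  · intro hf
    induction hf using Submodule.span_induction with
    | mem x hx =>
      obtain ⟨i, rfl⟩ := hx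
      have hi := i.2
      have hab : (2 * (i : ℕ) + 1) + (2 * (k - (i : ℕ)) - 1) = 2 * k := by omega
      refine ⟨?_, ?_, ?_⟩
      · have := (hhP.pow (2 * (i : ℕ) + 1)).mul (hhQ.pow (2 * (k - (i : ℕ)) - 1))
        rwa [← mul_add, hab, mul_comm m] at this
      · simp only
        rw [map_mul, map_pow, map_pow, htP, htQ, mul_pow, mul_pow, mul_mul_mul_comm, ← pow_add,
          hab, ← C_pow, pow_mul, he2, one_pow, C_1, one_mul]
      · simp only
        rw [hs _ _ hab]
        congr 1
        rw [pow_add, pow_add, pow_add, pow_mul (-1 : ℂ) 2]; simp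
    | zero => exact ⟨isHomogeneous_zero _ _ _, by simp, by simp⟩
    | add x y _ _ hx hy =>
      exact ⟨hx.1.add hy.1, by rw [map_add, hx.2.1, hy.2.1],
        by rw [map_add, hx.2.2, hy.2.2, smul_add]⟩
    | smul r x _ hx =>
      refine ⟨?_, by rw [map_smul, hx.2.1], by rw [map_smul, hx.2.2, smul_comm]⟩
      exact (homogeneousSubmodule (Fin 2) ℂ _).smul_mem r hx.1
end
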